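/- Let A be a commutative group and q₀ ∈ A an element of finite order r₀ ≥ 1. Inside ℤ define Λ_G = {n ∈ ℤ | q₀^(2nm) = 1 for all m ∈ ℤ} and Λ_G̃ = {n ∈ 2ℤ | q₀^(2nm) = 1 for all m ∈ 2ℤ} (the kernels of the bilinear form κ(m, n) = q₀^(2mn) on the coweight lattice ℤ of PGL₂ and on its sublattice 2ℤ, the coweight lattice of SL₂). Then: if r₀ is odd, Λ_G = r₀ℤ and Λ_G̃ = 2r₀ℤ = 2Λ_G; if r₀ ≡ 2 (mod 4), Λ_G = (r₀/2)ℤ and Λ_G̃ = r₀ℤ = 2Λ_G; if r₀ ≡ 4 (mod 8), Λ_G = (r₀/2)ℤ = Λ_G̃; and if 8 ∣ r₀, Λ_G = (r₀/2)ℤ and Λ_G̃ = (r₀/4)ℤ, so Λ_G = 2Λ_G̃. If instead q₀ has infinite order, then Λ_G = Λ_G̃ = {0}. -/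

import Mathlib

theorem aux_G {A : Type*} [CommGroup A] (q : A) :
    {n : ℤ | ∀ m : ℤ, q ^ (2 * n * m) = 1} = {n : ℤ | (orderOf q : ℤ) ∣ 2 * n} := by
  ext n
  simp only [Set.mem_setOf_eq, ← orderOf_dvd_iff_zpow_eq_one]
  constructor
  · intro h
    simpa using h 1
  · intro h m
    exact Dvd.dvd.mul_right h m

theorem aux_Gt {A : Type*} [CommGroup A] (q : A) :
    {n : ℤ | 2 ∣ n ∧ ∀ m : ℤ, 2 ∣ m → q ^ (2 * n * m) = 1}
      = {n : ℤ | 2 ∣ n ∧ (orderOf q : ℤ) ∣ 4 * n} := by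
  ext n
  simp only [Set.mem_setOf_eq, ← orderOf_dvd_iff_zpow_eq_one]
  refine and_congr_right fun _ => ?_
  constructor
  · intro h
    have h2 := h 2 (dvd_refl 2)
    rwa [show 2 * n * 2 = 4 * n by ring] at h2
  · rintro h m ⟨c, rfl⟩
    rw [show 2 * n * (2 * c) = 4 * n * c by ring]
    exact Dvd.dvd.mul_right h c

theorem aux_odd (k n : ℤ) (hk : Odd k) : k ∣ 2 * n ↔ k ∣ n := by
  have hc : IsCoprime k 2 := by
    obtain ⟨c, rfl⟩ := hk
    exact ⟨1, -c, by ring⟩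
  exact ⟨fun h => hc.dvd_of_dvd_mul_left h, fun h => Dvd.dvd.mul_left h 2⟩

theorem aux_two (k n : ℤ) (hk : Odd k) : (2 ∣ n ∧ k ∣ n) ↔ 2 * k ∣ n := by
  have hc : IsCoprime 2 k := by
    obtain ⟨c, rfl⟩ := hk
    exact ⟨-c, 1, by ring⟩
  exact ⟨fun h => hc.mul_dvd h.1 h.2,
    fun h => ⟨(Dvd.intro _ rfl).trans h, (Dvd.intro_left _ rfl).trans h⟩⟩

theorem aux_cancel (c k n : ℤ) (hc : c ≠ 0) : c * k ∣ c * n ↔ k ∣ n :=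
  mul_dvd_mul_iff_left hc

/-- Let `q₀ ∈ A` and put `r₀ = orderOf q₀`,
`Λ_G = {n : ℤ | ∀ m, q₀ ^ (2nm) = 1}` and
`Λ_G̃ = {n ∈ 2ℤ | ∀ m ∈ 2ℤ, q₀ ^ (2nm) = 1}` (kernels of the bilinear form
`κ(m,n) = q₀^{2mn}` on the coweight lattices of `PGL₂` and `SL₂`).  Then:
if `r₀` is odd, `Λ_G = r₀ℤ` and `Λ_G̃ = 2r₀ℤ`; if `r₀ ≡ 2 (mod 4)`, `Λ_G = (r₀/2)ℤ` and
`Λ_G̃ = r₀ℤ`; if `r₀ ≡ 4 (mod 8)`, `Λ_G = (r₀/2)ℤ = Λ_G̃`; if `8 ∣ r₀`,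
`Λ_G = (r₀/2)ℤ` and `Λ_G̃ = (r₀/4)ℤ`.  If `q₀` has infinite order, both lattices are `{0}`. -/
theorem stmt_11 {A : Type*} [CommGroup A] (q₀ : A) :
    (1 ≤ orderOf q₀ →
      (Odd (orderOf q₀) →
        {n : ℤ | ∀ m : ℤ, q₀ ^ (2 * n * m) = 1} = {n : ℤ | ((orderOf q₀ : ℤ)) ∣ n} ∧
        {n : ℤ | 2 ∣ n ∧ ∀ m : ℤ, 2 ∣ m → q₀ ^ (2 * n * m) = 1}
          = {n : ℤ | (2 * (orderOf q₀ : ℤ)) ∣ n}) ∧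
      (orderOf q₀ % 4 = 2 →
        {n : ℤ | ∀ m : ℤ, q₀ ^ (2 * n * m) = 1}
          = {n : ℤ | ((orderOf q₀ / 2 : ℕ) : ℤ) ∣ n} ∧
        {n : ℤ | 2 ∣ n ∧ ∀ m : ℤ, 2 ∣ m → q₀ ^ (2 * n * m) = 1}
          = {n : ℤ | ((orderOf q₀ : ℕ) : ℤ) ∣ n}) ∧
      (orderOf q₀ % 8 = 4 →
        {n : ℤ | ∀ m : ℤ, q₀ ^ (2 * n * m) = 1}
          = {n : ℤ | ((orderOf q₀ / 2 : ℕ) : ℤ) ∣ n} ∧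
        {n : ℤ | 2 ∣ n ∧ ∀ m : ℤ, 2 ∣ m → q₀ ^ (2 * n * m) = 1}
          = {n : ℤ | ((orderOf q₀ / 2 : ℕ) : ℤ) ∣ n}) ∧
      (8 ∣ orderOf q₀ →
        {n : ℤ | ∀ m : ℤ, q₀ ^ (2 * n * m) = 1}
          = {n : ℤ | ((orderOf q₀ / 2 : ℕ) : ℤ) ∣ n} ∧
        {n : ℤ | 2 ∣ n ∧ ∀ m : ℤ, 2 ∣ m → q₀ ^ (2 * n * m) = 1}
          = {n : ℤ | ((orderOf q₀ / 4 : ℕ) : ℤ) ∣ n})) ∧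
    (¬ IsOfFinOrder q₀ →
      {n : ℤ | ∀ m : ℤ, q₀ ^ (2 * n * m) = 1} = {0} ∧
      {n : ℤ | 2 ∣ n ∧ ∀ m : ℤ, 2 ∣ m → q₀ ^ (2 * n * m) = 1} = {0}) := by
  rw [aux_G, aux_Gt]
  refine ⟨fun _ => ?_, fun h => ?_⟩
  · generalize orderOf q₀ = r
    refine ⟨fun h => ?_, fun h => ?_, fun h => ?_, fun h => ?_⟩
    · have hr : Odd (r : ℤ) := by exact_mod_cast h
      refine ⟨?_, ?_⟩ <;> ext n <;> simp only [Set.mem_setOf_eq]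
      · exact aux_odd _ _ hr
      · rw [show 4 * n = 2 * (2 * n) by ring, aux_odd _ _ hr, aux_odd _ _ hr, aux_two _ _ hr]
    · obtain ⟨k, rfl⟩ : ∃ k, r = 2 * k := ⟨r / 2, by omega⟩
      have hk : Odd (k : ℤ) := by
        rw [Int.odd_iff]
        omega
      rw [show 2 * k / 2 = k by omega]
      push_cast
      refine ⟨?_, ?_⟩ <;> ext n <;> simp only [Set.mem_setOf_eq]
      · exact aux_cancel _ _ _ (by norm_num)
      · rw [show 4 * n = 2 * (2 * n) by ring, aux_cancel _ _ _ (by norm_num), aux_odd _ _ hk,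
          aux_two _ _ hk]
    · obtain ⟨k, rfl⟩ : ∃ k, r = 4 * k := ⟨r / 4, by omega⟩
      have hk : Odd (k : ℤ) := by
        rw [Int.odd_iff]
        omega
      rw [show 4 * k / 2 = 2 * k by omega]
      push_cast
      refine ⟨?_, ?_⟩ <;> ext n <;> simp only [Set.mem_setOf_eq]
      · rw [show (4 : ℤ) * k = 2 * (2 * k) by ring]
        exact aux_cancel _ _ _ (by norm_num)
      · rw [aux_cancel _ _ _ (by norm_num), aux_two _ _ hk]
    · obtain ⟨k, rfl⟩ := h
      rw [show 8 * k / 2 = 4 * k by omega, show 8 * k / 4 = 2 * k by omega]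
      push_cast
      refine ⟨?_, ?_⟩ <;> ext n <;> simp only [Set.mem_setOf_eq]
      · rw [show (8 : ℤ) * k = 2 * (4 * k) by ring]
        exact aux_cancel _ _ _ (by norm_num)
      · rw [show (8 : ℤ) * k = 4 * (2 * k) by ring, aux_cancel _ _ _ (by norm_num)]
        exact ⟨fun h => h.2, fun h => ⟨(Dvd.intro _ rfl).trans h, h⟩⟩
  · rw [orderOf_eq_zero h]
    refine ⟨?_, ?_⟩ <;> ext n <;>
      simp only [Set.mem_setOf_eq, Set.mem_singleton_iff, Nat.cast_zero, zero_dvd_iff] <;> omega
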